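/- For every integer n ≥ 0 and an indeterminate q (in a field where the relevant denominators are nonzero), one has (1+z)(z;q)_n (z^{-1};q)_n / (q;q)_{2n} = Σ_{j=-n}^{n+1} (-1)^{j+1} (1 - q^{2j-1}) z^j q^{j(j-3)/2+1} / ((q;q)_{n+j} (q;q)_{n-j+1}), where (a;q)_m = ∏_{i=0}^{m-1}(1 - a q^i). -/

import Mathlib

open Finset

/-- The finite q-Pochhammer symbol `(a;q)_m = ∏_{i=0}^{m-1} (1 - a q^i)`. -/
def qPoch {K : Type*} [Field K] (a q : K) (m : ℕ) : K :=
  ∏ i ∈ Finset.range m, (1 - a * q ^ i)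

theorem qPoch_succ {K : Type*} [Field K] (a q : K) (m : ℕ) :
    qPoch a q (m + 1) = qPoch a q m * (1 - a * q ^ m) :=
  Finset.prod_range_succ _ _

/-- The reciprocal `1 / (q;q)_m`, extended by zero to negative `m`. -/
def qPochRecip {K : Type*} [Field K] (q : K) (m : ℤ) : K :=
  if m < 0 then 0 else (qPoch q q m.toNat)⁻¹

theorem qPochRecip_of_neg {K : Type*} [Field K] (q : K) {m : ℤ} (hm : m < 0) :
    qPochRecip q m = 0 :=
  if_pos hm

theorem qPochRecip_of_nonneg {K : Type*} [Field K] (q : K) {m : ℤ} (hm : 0 ≤ m) :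
    qPochRecip q m = (qPoch q q m.toNat)⁻¹ :=
  if_neg hm.not_gt

theorem qPochRecip_eq_succ_mul {K : Type*} [Field K] {q : K}
    (hden : ∀ m : ℕ, qPoch q q m ≠ 0) (m : ℤ) :
    qPochRecip q m = qPochRecip q (m + 1) * (1 - q ^ (m + 1)) := by
  rcases lt_trichotomy m (-1) with h | rfl | h
  · rw [qPochRecip_of_neg q (by omega), qPochRecip_of_neg q (by omega), zero_mul]
  · simp [qPochRecip]
  · lift m to ℕ using by omega
    have hs := qPoch_succ q q m
    have h1 := hden m
    have h2 := hden (m + 1)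
    rw [qPochRecip_of_nonneg q (by omega), qPochRecip_of_nonneg q (by omega)]
    have e : ((m : ℤ) + 1).toNat = m + 1 := by omega
    rw [e, Int.toNat_natCast, inv_mul_eq_div, eq_div_iff h2, hs, inv_mul_cancel_left₀ h1]
    norm_cast
    rw [pow_succ']

/-- The summand of the finite Jacobi-type expansion, extended by zero to all integers `j`. -/
def garvanTerm {K : Type*} [Field K] (q z : K) (n : ℕ) (j : ℤ) : K :=
  (-1 : K) ^ (j + 1) * (1 - q ^ (2 * j - 1)) * z ^ j * q ^ (j * (j - 3) / 2 + 1)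
    * (qPochRecip q ((n : ℤ) + j) * qPochRecip q ((n : ℤ) - j + 1))

theorem support_garvanTerm_subset {K : Type*} [Field K] (q z : K) (n : ℕ) :
    Function.support (garvanTerm q z n) ⊆ ↑(Finset.Icc (-(n : ℤ)) ((n : ℤ) + 1)) := by
  intro j hj
  by_contra h
  apply hj
  rw [Finset.coe_Icc, Set.mem_Icc, not_and_or, not_le, not_le] at h
  rcases h with h | h
  · simp [garvanTerm, qPochRecip_of_neg q (show (n : ℤ) + j < 0 by omega)]
  · simp [garvanTerm, qPochRecip_of_neg q (show (n : ℤ) - j + 1 < 0 by omega)]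

theorem garvanTerm_recurrence {K : Type*} [Field K] {q z : K} (hq : q ≠ 0) (hz : z ≠ 0)
    (hden : ∀ m : ℕ, qPoch q q m ≠ 0) (n : ℕ) (j : ℤ) :
    (1 - q ^ (2 * n + 1)) * (1 - q ^ (2 * n + 2)) * garvanTerm q z (n + 1) j
      = (1 + q ^ (2 * n)) * garvanTerm q z n j
        + (-(q ^ n * z) * garvanTerm q z n (j - 1)
          + -(q ^ n * z⁻¹) * garvanTerm q z n (j + 1)) := by
  have hup : (j + 1) * (j + 1 - 3) / 2 = j * (j - 3) / 2 + (j - 1) := by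
    rw [← Int.add_mul_ediv_right _ _ two_ne_zero]; ring_nf
  have hdown : (j - 1) * (j - 1 - 3) / 2 = j * (j - 3) / 2 + (2 - j) := by
    rw [← Int.add_mul_ediv_right _ _ two_ne_zero]; ring_nf
  have hl1 := qPochRecip_eq_succ_mul hden ((n : ℤ) + j)
  have hl2 := qPochRecip_eq_succ_mul hden ((n : ℤ) + j - 1)
  have hr1 := qPochRecip_eq_succ_mul hden ((n : ℤ) - j + 1)
  have hr2 := qPochRecip_eq_succ_mul hden ((n : ℤ) - j)
  rw [sub_add_cancel] at hl2
  rw [hl1] at hl2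
  rw [hr1] at hr2
  have e1 : ((n + 1 : ℕ) : ℤ) + j = n + j + 1 := by push_cast; ring
  have e2 : ((n + 1 : ℕ) : ℤ) - j + 1 = n - j + 1 + 1 := by push_cast; ring
  have e3 : (n : ℤ) + (j - 1) = n + j - 1 := by ring
  have e4 : (n : ℤ) - (j - 1) + 1 = n - j + 1 + 1 := by ring
  have e5 : (n : ℤ) + (j + 1) = n + j + 1 := by ring
  have e6 : (n : ℤ) - (j + 1) + 1 = n - j := by ring
  simp only [garvanTerm, hup, hdown, e1, e2, e3, e4, e5, e6]
  rw [hl2, hr2, hl1, hr1]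
  generalize qPochRecip q ((n : ℤ) + j + 1) = R
  generalize qPochRecip q ((n : ℤ) - j + 1 + 1) = S
  generalize j * (j - 3) / 2 = e
  have hm : (-1 : K) ≠ 0 := by simp
  simp only [two_mul, zpow_add₀ hq, zpow_sub₀ hq, zpow_add₀ hz, zpow_sub₀ hz, zpow_add₀ hm,
    zpow_sub₀ hm, zpow_natCast, pow_add, zpow_ofNat, pow_one]
  have hA : q ^ j ≠ 0 := zpow_ne_zero _ hq
  generalize q ^ j = A at *
  generalize q ^ n = N
  generalize q ^ e = E
  generalize z ^ j = Z
  generalize (-1 : K) ^ j = s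
  field_simp
  ring

theorem finsum_garvanTerm_succ {K : Type*} [Field K] {q z : K} (hq : q ≠ 0) (hz : z ≠ 0)
    (hden : ∀ m : ℕ, qPoch q q m ≠ 0) (n : ℕ) :
    (1 - q ^ (2 * n + 1)) * (1 - q ^ (2 * n + 2)) * ∑ᶠ j, garvanTerm q z (n + 1) j
      = (1 - z * q ^ n) * (1 - z⁻¹ * q ^ n) * ∑ᶠ j, garvanTerm q z n j := by
  have hfin (m : ℕ) : (Function.support (garvanTerm q z m)).Finite :=
    (Finset.finite_toSet _).subset (support_garvanTerm_subset q z m)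
  have hmul (c : K) {f : ℤ → K} (hf : (Function.support f).Finite) :
      (Function.support fun j => c * f j).Finite :=
    hf.subset (Function.support_mul_subset_right _ _)
  have hdown : (Function.support fun j => garvanTerm q z n (j - 1)).Finite :=
    (hfin n).preimage (Equiv.subRight (1 : ℤ)).injective.injOn
  have hup : (Function.support fun j => garvanTerm q z n (j + 1)).Finite :=
    (hfin n).preimage (Equiv.addRight (1 : ℤ)).injective.injOn
  have sdown : ∑ᶠ j, garvanTerm q z n (j - 1) = ∑ᶠ j, garvanTerm q z n j :=
    finsum_comp_equiv (Equiv.subRight (1 : ℤ))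
  have sup : ∑ᶠ j, garvanTerm q z n (j + 1) = ∑ᶠ j, garvanTerm q z n j :=
    finsum_comp_equiv (Equiv.addRight (1 : ℤ))
  rw [mul_finsum, finsum_congr (garvanTerm_recurrence hq hz hden n),
    finsum_add_distrib (hmul _ (hfin n))
      (((hmul _ hdown).union (hmul _ hup)).subset (Function.support_add _ _)),
    finsum_add_distrib (hmul _ hdown) (hmul _ hup), ← mul_finsum,
    ← mul_finsum, ← mul_finsum, sdown, sup]
  field_simp
  ring

theorem finsum_garvanTerm {K : Type*} [Field K] (q z : K) (n : ℕ) :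
    ∑ᶠ j, garvanTerm q z n j = ∑ j ∈ Finset.Icc (-(n : ℤ)) ((n : ℤ) + 1),
      (-1 : K) ^ (j + 1) * (1 - q ^ (2 * j - 1)) * z ^ j * q ^ (j * (j - 3) / 2 + 1)
        / (qPoch q q ((n : ℤ) + j).toNat * qPoch q q ((n : ℤ) - j + 1).toNat) := by
  rw [finsum_eq_sum_of_support_subset _ (support_garvanTerm_subset q z n)]
  refine Finset.sum_congr rfl fun j hj => ?_
  rw [Finset.mem_Icc] at hj
  rw [garvanTerm, qPochRecip_of_nonneg q (by omega), qPochRecip_of_nonneg q (by omega),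
    ← mul_inv, div_eq_mul_inv]

/-- Lemma 4.1 of Garvan: for `n ≥ 0`,
`(1+z)(z;q)_n(z⁻¹;q)_n / (q;q)_{2n}
  = Σ_{j=-n}^{n+1} (-1)^{j+1}(1-q^{2j-1}) z^j q^{j(j-3)/2+1} / ((q;q)_{n+j}(q;q)_{n-j+1})`. -/
theorem garvan_lemma_4_1 {K : Type*} [Field K] (q z : K) (hq : q ≠ 0) (hz : z ≠ 0)
    (hden : ∀ m : ℕ, qPoch q q m ≠ 0) (n : ℕ) :
    (1 + z) * qPoch z q n * qPoch z⁻¹ q n / qPoch q q (2 * n)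
      = ∑ j ∈ Finset.Icc (-(n : ℤ)) ((n : ℤ) + 1),
          (-1 : K) ^ (j + 1) * (1 - q ^ (2 * j - 1)) * z ^ j * q ^ (j * (j - 3) / 2 + 1)
            / (qPoch q q ((n : ℤ) + j).toNat * qPoch q q ((n : ℤ) - j + 1).toNat) := by
  rw [← finsum_garvanTerm]
  induction n with
  | zero =>
    have h1 : 1 - q ≠ 0 := by simpa [qPoch] using hden 1
    have hIcc : Finset.Icc (0 : ℤ) 1 = {0, 1} := rfl
    rw [finsum_garvanTerm]
    simp [hIcc, qPoch]
    field_simp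
  | succ n ih =>
    have h0 := hden (2 * n)
    have h2 := hden (2 * n + 1 + 1)
    rw [qPoch_succ, qPoch_succ, ← pow_succ', ← pow_succ'] at h2
    have hb := right_ne_zero_of_mul h2
    have ha := right_ne_zero_of_mul (left_ne_zero_of_mul h2)
    apply mul_left_cancel₀ (mul_ne_zero ha hb)
    rw [finsum_garvanTerm_succ hq hz hden, ← ih, mul_add_one, ← add_assoc (2 * n) 1 1,
      qPoch_succ q, qPoch_succ q, qPoch_succ z, qPoch_succ z⁻¹, ← pow_succ', ← pow_succ']
    field_simp
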